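/- There exists a 7-dimensional linear subspace W of the space of alternating bilinear forms on V = ℂ⁷ such that every nonzero form w ∈ W has rank equal to 4 or to 6; equivalently, every class [w] ∈ Y_W is represented by a form of rank exactly 4, and every [w] ∈ ℙW ∖ Y_W is represented by a form of rank exactly 6. -/

import Mathlib

open Module

/-- The rank of an alternating bilinear form over a field of characteristic not two is even. -/
theorem LinearMap.IsAlt.even_finrank_range {K V : Type*} [Field K] [NeZero (2 : K)]
    [AddCommGroup V] [Module K V] [FiniteDimensional K V] {B : V →ₗ[K] V →ₗ[K] K}
    (hB : B.IsAlt) : Even (finrank K (LinearMap.range B)) := by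
  obtain ⟨C, hC⟩ := (LinearMap.ker B).exists_isCompl
  have hrank : finrank K (LinearMap.range B) = finrank K C :=
    ((LinearMap.ker B).quotientEquivOfIsCompl C hC |>.symm.trans
      B.quotKerEquivRange).finrank_eq.symm
  let D : C →ₗ[K] C →ₗ[K] K := B.domRestrict₁₂ C C
  have hDalt : D.IsAlt := fun x => hB x
  have hnd : D.Nondegenerate := by
    rw [hDalt.isRefl.nondegenerate_iff_separatingLeft]
    intro x hx
    have hxker : (x : V) ∈ LinearMap.ker B := by
      ext y
      obtain ⟨k, hk, c, hc, rfl⟩ := Submodule.mem_sup.1 (hC.sup_eq_top ▸ Submodule.mem_top (x := y))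
      have hk' : B x k = 0 := hB.isRefl _ _ (by rw [LinearMap.mem_ker.1 hk, LinearMap.zero_apply])
      have hc' : B x c = 0 := hx ⟨c, hc⟩
      simp [hk', hc']
    exact Subtype.ext (Submodule.disjoint_def.1 hC.disjoint _ hxker x.2)
  let b := finBasis K C
  have hdet := (LinearMap.BilinForm.nondegenerate_iff_det_ne_zero b).1 hnd
  have hskew : (LinearMap.BilinForm.toMatrix b D).transpose = -LinearMap.BilinForm.toMatrix b D := by
    ext i j
    rw [Matrix.transpose_apply, Matrix.neg_apply, LinearMap.BilinForm.toMatrix_apply,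
      LinearMap.BilinForm.toMatrix_apply, hDalt.neg]
  rw [hrank]
  by_contra hodd
  rw [Nat.not_even_iff_odd] at hodd
  have h := congrArg Matrix.det hskew
  rw [Matrix.det_transpose, Matrix.det_neg, Fintype.card_fin, hodd.neg_one_pow, neg_one_mul] at h
  have h2 : (2 : K) * (LinearMap.BilinForm.toMatrix b D).det = 0 := by linear_combination h
  exact hdet ((mul_eq_zero.1 h2).resolve_left two_ne_zero)

/-- A bilinear form with a nonsingular Gram matrix of size `n` has rank at least `n`. -/
theorem LinearMap.card_le_finrank_range_of_det_ne_zero {K V ι : Type*} [Field K]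
    [AddCommGroup V] [Module K V] [FiniteDimensional K V] [Fintype ι] [DecidableEq ι]
    (B : V →ₗ[K] V →ₗ[K] K) (v : ι → V)
    (h : (Matrix.of fun i j => B (v i) (v j)).det ≠ 0) :
    Fintype.card ι ≤ finrank K (LinearMap.range B) := by
  let e : (V →ₗ[K] K) →ₗ[K] (ι → K) := LinearMap.pi fun j => LinearMap.applyₗ (v j)
  have hli : LinearIndependent K fun i => B (v i) :=
    LinearIndependent.of_comp e (Matrix.linearIndependent_rows_of_det_ne_zero h)
  have hli' : LinearIndependent K fun i => (⟨B (v i), v i, rfl⟩ : LinearMap.range B) :=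
    LinearIndependent.of_comp (LinearMap.range B).subtype hli
  exact hli'.fintype_card_le_finrank

/-- The skew-symmetric matrix whose entry in position `i < j` is `a (i + j - 3)`, read as `0` when
`i + j - 3` is not in `{0, …, 6}`. -/
def skewHankel {K : Type*} [Field K] (a : Fin 7 → K) : Matrix (Fin 7) (Fin 7) K :=
  !![0, 0, 0, a 0, a 1, a 2, a 3;
     0, 0, a 0, a 1, a 2, a 3, a 4;
     0, -a 0, 0, a 2, a 3, a 4, a 5;
     -a 0, -a 1, -a 2, 0, a 4, a 5, a 6;
     -a 1, -a 2, -a 3, -a 4, 0, a 6, 0;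
     -a 2, -a 3, -a 4, -a 5, -a 6, 0, 0;
     -a 3, -a 4, -a 5, -a 6, 0, 0, 0]

/-- A nonzero `skewHankel` matrix has a nonsingular principal `4 × 4` submatrix. -/
theorem exists_det_submatrix_skewHankel_ne_zero {K : Type*} [Field K] {a : Fin 7 → K}
    (ha : a ≠ 0) : ∃ r : Fin 4 → Fin 7, ((skewHankel a).submatrix r r).det ≠ 0 := by
  obtain ⟨k, hk, hmin⟩ : ∃ k, a k ≠ 0 ∧ ∀ j < k, a j = 0 := by
    obtain ⟨k, hk, hmin⟩ := WellFounded.has_min (wellFounded_lt (α := Fin 7)) {k | a k ≠ 0}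
      (Function.ne_iff.1 ha)
    exact ⟨k, hk, fun j hj => by_contra fun h => hmin j h hj⟩
  -- The rows `i < j < k < l` satisfy `i + l = j + k`, which makes the submatrix anti-triangular.
  let r : Fin 4 → Fin 7 := ![![0, 1, 2, 3], ![0, 1, 3, 4], ![0, 1, 4, 5], ![0, 1, 5, 6],
    ![1, 2, 5, 6], ![2, 3, 5, 6], ![3, 4, 5, 6]] k
  refine ⟨r, ?_⟩
  have hdet : ((skewHankel a).submatrix r r).det = a k ^ 4 := by
    have h0 := hmin 0
    have h1 := hmin 1
    have h2 := hmin 2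
    have h3 := hmin 3
    have h4 := hmin 4
    have h5 := hmin 5
    clear hmin hk
    simp only [Matrix.det_succ_row_zero, Matrix.det_fin_zero, Matrix.submatrix_apply,
      Fin.sum_univ_succ, Fin.sum_univ_zero]
    fin_cases k <;> simp at h0 h1 h2 h3 h4 h5 <;>
      simp [r, skewHankel, Fin.succAbove, *] <;> ring
  rw [hdet]
  exact pow_ne_zero 4 hk

/-- The alternating form with Gram matrix `skewHankel a`, as a linear function of `a`. -/
noncomputable def skewHankelForm (K : Type*) [Field K] :
    (Fin 7 → K) →ₗ[K] (Fin 7 → K) →ₗ[K] (Fin 7 → K) →ₗ[K] K :=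
  (Matrix.toLinearMap₂' K).toLinearMap ∘ₗ
    { toFun := skewHankel
      map_add' := fun a b => by
        ext i j
        fin_cases i <;> fin_cases j <;> simp [skewHankel, add_comm]
      map_smul' := fun c a => by
        ext i j
        fin_cases i <;> fin_cases j <;> simp [skewHankel] }

theorem skewHankelForm_isAlt {K : Type*} [Field K] (a : Fin 7 → K) :
    (skewHankelForm K a).IsAlt := fun v => by
  simp [skewHankelForm, Matrix.toLinearMap₂'_apply, skewHankel, Fin.sum_univ_succ]
  ring

theorem four_le_finrank_range_skewHankelForm {K : Type*} [Field K] {a : Fin 7 → K} (ha : a ≠ 0) :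
    4 ≤ finrank K (LinearMap.range (skewHankelForm K a)) := by
  obtain ⟨r, hr⟩ := exists_det_submatrix_skewHankel_ne_zero ha
  refine (skewHankelForm K a).card_le_finrank_range_of_det_ne_zero
    (fun i => Pi.single (r i) 1) ?_
  convert hr using 2
  ext i j
  simp [skewHankelForm, Matrix.toLinearMap₂'_apply, Pi.single_apply]

theorem skewHankelForm_injective {K : Type*} [Field K] :
    Function.Injective (skewHankelForm K) := by
  rw [injective_iff_map_eq_zero]
  intro a h
  by_contra ha
  have := four_le_finrank_range_skewHankelForm ha
  rw [h, LinearMap.range_zero, finrank_bot] at this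
  omega



/-- **Proposition.** There is a 7-dimensional space `W` of alternating bilinear forms on
`V = ℂ⁷` such that every nonzero form `w ∈ W` has rank `4` or `6` (the rank of `w` being the
rank of the induced linear map `V → V^∨`); equivalently, every point of the Pfaffian locus
`Y_W ⊆ ℙW` is represented by a form of rank exactly `4`, and every point of `ℙW ∖ Y_W` by a
form of rank exactly `6`. -/
theorem exists_seven_dim_space_of_alternating_forms_rank_four_or_six :
    ∃ W : Submodule ℂ ((Fin 7 → ℂ) →ₗ[ℂ] (Fin 7 → ℂ) →ₗ[ℂ] ℂ),
      (∀ w ∈ W, ∀ v : Fin 7 → ℂ, w v v = 0) ∧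
      finrank ℂ W = 7 ∧
      ∀ w ∈ W, w ≠ 0 →
        finrank ℂ (LinearMap.range w) = 4 ∨ finrank ℂ (LinearMap.range w) = 6 := by
  refine ⟨LinearMap.range (skewHankelForm ℂ), ?_, ?_, ?_⟩
  · rintro _ ⟨a, rfl⟩
    exact skewHankelForm_isAlt a
  · rw [LinearMap.finrank_range_of_inj skewHankelForm_injective, finrank_fin_fun]
  · rintro _ ⟨a, rfl⟩ hw
    have hlow := four_le_finrank_range_skewHankelForm (K := ℂ) (a := a) fun h => hw (by simp [h])
    have heven := (skewHankelForm_isAlt a).even_finrank_range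
    have hupp := (skewHankelForm ℂ a).finrank_range_le
    rw [finrank_fin_fun] at hupp
    rw [Nat.even_iff] at heven
    omega
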